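/- Fix integers m₁, m₂ ≥ 1, real numbers 0 < t₀ ≤ 1 ≤ T, C > 0, B > 0 and δ > 0, and set α_t = e^(−t/2), σ_t = √(1 − e^(−t)). For a measurable function s : ℝ^(m₁) × ℝ^(m₂) × ℝ → ℝ^(m₁) and x ∈ ℝ^(m₁), y ∈ ℝ^(m₂), define the truncated loss ℓ^trunc(x, y; s) = ∫_{t₀}^{T} E_{z~N(0,I_{m₁})}[ ‖s(α_t x + σ_t z, y, t) + z/σ_t‖₂² · 1{‖x‖₂ ≤ C and ‖α_t x + σ_t z‖₂ ≤ C} ] dt. Let s₁, s₂ be measurable functions with ‖s_i(v, y, t)‖₂ ≤ σ_t^(−2)·B for all v, y and all t ∈ [t₀, T] (i = 1, 2), and suppose ‖s₁(v, y, t) − s₂(v, y, t)‖₂ ≤ δ for all t ∈ [t₀, T] and all v ∈ ℝ^(m₁), y ∈ ℝ^(m₂) with ‖v‖₂ ≤ C and ‖y‖₂ ≤ C. Then for all x, y with ‖x‖₂ ≤ C and ‖y‖₂ ≤ C: |ℓ^trunc(x, y; s₁) − ℓ^trunc(x, y; s₂)| ≤ 4δ·(T + log(1/t₀))·(B + √(m₁)).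 -/

import Mathlib

open Matrix MeasureTheory
open scoped BigOperators

noncomputable section

/-- Euclidean norm of a finitely-indexed real vector. -/
def norm2 {ι : Type*} [Fintype ι] (v : ι → ℝ) : ℝ := Real.sqrt (∑ i, v i ^ 2)

/-- Density of the multivariate Gaussian `N(μ, Σ)` with respect to Lebesgue measure. -/
def gaussDensity {ι : Type*} [Fintype ι] [DecidableEq ι]
    (μ : ι → ℝ) (S : Matrix ι ι ℝ) (x : ι → ℝ) : ℝ :=
  (Real.sqrt ((2 * Real.pi) ^ (Fintype.card ι) * S.det))⁻¹ *
    Real.exp (-((x - μ) ⬝ᵥ (S⁻¹ *ᵥ (x - μ))) / 2)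

/-- The multivariate Gaussian measure `N(μ, Σ)` on `ι → ℝ`, defined through its
density with respect to Lebesgue measure. -/
def gaussMeasure {ι : Type*} [Fintype ι] [DecidableEq ι]
    (μ : ι → ℝ) (S : Matrix ι ι ℝ) : Measure (ι → ℝ) :=
  volume.withDensity (fun x => ENNReal.ofReal (gaussDensity μ S x))

/-- `α_t = e^{-t/2}` for the forward Ornstein–Uhlenbeck process. -/
def OUalpha (t : ℝ) : ℝ := Real.exp (-t/2)

/-- `σ_t = √(1 − e^{-t})` for the forward Ornstein–Uhlenbeck process. -/
def OUsigma (t : ℝ) : ℝ := Real.sqrt (1 - Real.exp (-t))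

/-- The truncated denoising score-matching loss
`ℓ^trunc(x, y; s) = ∫_{t₀}^{T} E_{z ~ N(0,I)}[‖s(α_t x + σ_t z, y, t) + z/σ_t‖₂²
  · 1{‖x‖₂ ≤ C, ‖α_t x + σ_t z‖₂ ≤ C}] dt`. -/
def ltrunc (m₁ m₂ : ℕ) (t₀ T C : ℝ)
    (s : (Fin m₁ → ℝ) → (Fin m₂ → ℝ) → ℝ → (Fin m₁ → ℝ))
    (x : Fin m₁ → ℝ) (y : Fin m₂ → ℝ) : ℝ :=
  ∫ t in t₀..T,
    ∫ z, Set.indicator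
        {z' : Fin m₁ → ℝ | norm2 x ≤ C ∧ norm2 (OUalpha t • x + OUsigma t • z') ≤ C}
        (fun z' =>
          (norm2 (s (OUalpha t • x + OUsigma t • z') y t + (OUsigma t)⁻¹ • z')) ^ 2) z
      ∂(gaussMeasure (0 : Fin m₁ → ℝ) (1 : Matrix (Fin m₁) (Fin m₁) ℝ))

lemma norm2_eq {ι : Type*} [Fintype ι] (v : ι → ℝ) : norm2 v = ‖WithLp.toLp 2 v‖ := by
  simp [norm2, EuclideanSpace.norm_eq]

lemma norm2_nonneg {ι : Type*} [Fintype ι] (v : ι → ℝ) : 0 ≤ norm2 v := Real.sqrt_nonneg _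

lemma norm2_add_le {ι : Type*} [Fintype ι] (v w : ι → ℝ) :
    norm2 (v + w) ≤ norm2 v + norm2 w := by
  simp only [norm2_eq, WithLp.toLp_add]; exact norm_add_le _ _

lemma norm2_smul {ι : Type*} [Fintype ι] (c : ℝ) (v : ι → ℝ) :
    norm2 (c • v) = |c| * norm2 v := by
  simp only [norm2_eq, WithLp.toLp_smul, norm_smul, Real.norm_eq_abs]

lemma abs_norm2_sub_le {ι : Type*} [Fintype ι] (v w : ι → ℝ) :
    |norm2 v - norm2 w| ≤ norm2 (v - w) := by
  simp only [norm2_eq, WithLp.toLp_sub]; exact abs_norm_sub_norm_le _ _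

lemma norm2_sq {ι : Type*} [Fintype ι] (v : ι → ℝ) : norm2 v ^ 2 = ∑ i, v i ^ 2 :=
  Real.sq_sqrt (Finset.sum_nonneg fun i _ => sq_nonneg _)

lemma measurable_norm2 {ι : Type*} [Fintype ι] : Measurable (norm2 : (ι → ℝ) → ℝ) := by
  unfold norm2; fun_prop

lemma gaussMeasure_std (m : ℕ) :
    gaussMeasure (0 : Fin m → ℝ) (1 : Matrix (Fin m) (Fin m) ℝ) =
      Measure.pi (fun _ => ProbabilityTheory.gaussianReal 0 1) := by
  symm
  apply Measure.pi_eq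
  intro s hs
  have hd : ∀ z : Fin m → ℝ, gaussDensity 0 (1 : Matrix (Fin m) (Fin m) ℝ) z =
      ∏ i, ProbabilityTheory.gaussianPDFReal 0 1 (z i) := by
    intro z
    simp only [gaussDensity, ProbabilityTheory.gaussianPDFReal, Finset.prod_mul_distrib,
      ← Real.exp_sum]
    congr 1
    · simp [Real.sqrt_eq_rpow]
      rw [← Real.rpow_natCast, ← Real.rpow_natCast, ← Real.rpow_mul (by positivity),
        ← Real.rpow_mul (by positivity), mul_comm (m : ℝ)]
    · simp [dotProduct, ← Finset.sum_div, pow_two]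
  have hint : Integrable (fun z : Fin m → ℝ => ∏ i, ProbabilityTheory.gaussianPDFReal 0 1 (z i)) :=
    Integrable.fintype_prod (fun i => ProbabilityTheory.integrable_gaussianPDFReal 0 1)
  rw [gaussMeasure, withDensity_apply _ (MeasurableSet.univ_pi hs)]
  simp only [hd]
  rw [← ofReal_integral_eq_lintegral_ofReal hint.integrableOn
    (ae_of_all _ fun z => Finset.prod_nonneg fun i _ =>
      ProbabilityTheory.gaussianPDFReal_nonneg _ _ _)]
  rw [← integral_indicator (MeasurableSet.univ_pi hs)]
  have : (Set.univ.pi s).indicator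
      (fun z : Fin m → ℝ => ∏ i, ProbabilityTheory.gaussianPDFReal 0 1 (z i)) =
      fun z => ∏ i, (s i).indicator (ProbabilityTheory.gaussianPDFReal 0 1) (z i) := by
    funext z
    by_cases h : z ∈ Set.univ.pi s
    · rw [Set.indicator_of_mem h]
      exact Finset.prod_congr rfl fun i _ => (Set.indicator_of_mem (h i trivial) _).symm
    · rw [Set.indicator_of_notMem h]
      simp only [Set.mem_pi, Set.mem_univ, true_imp_iff, not_forall] at h
      obtain ⟨i, hi⟩ := h
      exact (Finset.prod_eq_zero (Finset.mem_univ i) (Set.indicator_of_notMem hi _)).symm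
  rw [this, integral_fintype_prod_volume_eq_prod
      (fun i => (s i).indicator (ProbabilityTheory.gaussianPDFReal 0 1)),
    ENNReal.ofReal_prod_of_nonneg]
  · refine Finset.prod_congr rfl fun i _ => ?_
    rw [ProbabilityTheory.gaussianReal_apply_eq_integral _ one_ne_zero, integral_indicator (hs i)]
  · intro i _
    exact integral_nonneg fun x => Set.indicator_nonneg
      (fun _ _ => ProbabilityTheory.gaussianPDFReal_nonneg _ _ _) _

instance gaussMeasure_std_prob (m : ℕ) :
    IsProbabilityMeasure (gaussMeasure (0 : Fin m → ℝ) (1 : Matrix (Fin m) (Fin m) ℝ)) := by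
  rw [gaussMeasure_std]; infer_instance

lemma integrable_sq_gaussianReal :
    Integrable (fun x : ℝ => x ^ 2) (ProbabilityTheory.gaussianReal 0 1) := by
  have := (ProbabilityTheory.memLp_id_gaussianReal (μ := 0) (v := 1) 2).integrable_sq
  simpa using this

lemma integral_sq_gaussianReal :
    ∫ x : ℝ, x ^ 2 ∂(ProbabilityTheory.gaussianReal 0 1) = 1 := by
  have h := ProbabilityTheory.variance_id_gaussianReal (μ := 0) (v := 1)
  rw [ProbabilityTheory.variance_of_integral_eq_zero aemeasurable_id (by simp)] at h
  simpa using h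

lemma integrable_norm2_sq (m : ℕ) :
    Integrable (fun z : Fin m → ℝ => norm2 z ^ 2)
      (gaussMeasure (0 : Fin m → ℝ) (1 : Matrix (Fin m) (Fin m) ℝ)) := by
  rw [gaussMeasure_std]
  simp only [norm2_sq]
  refine integrable_finset_sum _ fun i _ => ?_
  exact integrable_comp_eval (μ := fun _ : Fin m => ProbabilityTheory.gaussianReal 0 1)
    integrable_sq_gaussianReal

lemma integral_norm2_sq (m : ℕ) :
    ∫ z : Fin m → ℝ, norm2 z ^ 2
      ∂(gaussMeasure (0 : Fin m → ℝ) (1 : Matrix (Fin m) (Fin m) ℝ)) = m := by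
  rw [gaussMeasure_std]
  simp only [norm2_sq]
  rw [integral_finset_sum _ fun i _ => 
    integrable_comp_eval (μ := fun _ : Fin m => ProbabilityTheory.gaussianReal 0 1)
    integrable_sq_gaussianReal]
  have : ∀ i : Fin m, ∫ z : Fin m → ℝ, z i ^ 2
      ∂(Measure.pi (fun _ : Fin m => ProbabilityTheory.gaussianReal 0 1)) = 1 := fun i => by
    rw [integral_comp_eval (μ := fun _ : Fin m => ProbabilityTheory.gaussianReal 0 1)
      (f := fun x : ℝ => x ^ 2) integrable_sq_gaussianReal.aestronglyMeasurable,
      integral_sq_gaussianReal]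
  simp [this]

lemma OUsigma_sq_inv_le {t : ℝ} (ht : 0 < t) : ((OUsigma t) ^ 2)⁻¹ ≤ 1 + t⁻¹ := by
  have h1 : Real.exp (-t) ≤ 1 / (1 + t) := by
    rw [Real.exp_neg, ← one_div]
    exact one_div_le_one_div_of_le (by linarith) (by linarith [Real.add_one_le_exp t])
  have h2 : t / (1 + t) ≤ 1 - Real.exp (-t) := by
    have : t / (1 + t) = 1 - 1 / (1 + t) := by field_simp; ring
    linarith
  have h3 : 0 < t / (1 + t) := by positivity
  rw [OUsigma, Real.sq_sqrt (by linarith)]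
  calc (1 - Real.exp (-t))⁻¹ ≤ (t / (1 + t))⁻¹ := inv_anti₀ h3 h2
    _ = 1 + t⁻¹ := by field_simp; ring

lemma OUsigma_inv_le {t : ℝ} (ht : 0 < t) : |(OUsigma t)⁻¹| ≤ ((OUsigma t) ^ 2)⁻¹ := by
  have h1 : Real.exp (-t) < 1 := by simpa using ht
  have h2 : 0 < OUsigma t := Real.sqrt_pos.2 (by linarith)
  have h3 : OUsigma t ≤ 1 := Real.sqrt_le_one.2 (by linarith [Real.exp_pos (-t)])
  rw [abs_of_pos (by positivity)]
  exact inv_anti₀ (by positivity) (by nlinarith)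

/-- the integrand -/
def FF (m₁ m₂ : ℕ) (C : ℝ) (s : (Fin m₁ → ℝ) → (Fin m₂ → ℝ) → ℝ → (Fin m₁ → ℝ))
    (x : Fin m₁ → ℝ) (y : Fin m₂ → ℝ) (t : ℝ) (z : Fin m₁ → ℝ) : ℝ :=
  Set.indicator
        {z' : Fin m₁ → ℝ | norm2 x ≤ C ∧ norm2 (OUalpha t • x + OUsigma t • z') ≤ C}
        (fun z' =>
          (norm2 (s (OUalpha t • x + OUsigma t • z') y t + (OUsigma t)⁻¹ • z')) ^ 2) z

lemma FF_meas (m₁ m₂ : ℕ) (C : ℝ) (s : (Fin m₁ → ℝ) → (Fin m₂ → ℝ) → ℝ → (Fin m₁ → ℝ))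
    (hmeas : Measurable fun p : (Fin m₁ → ℝ) × (Fin m₂ → ℝ) × ℝ => s p.1 p.2.1 p.2.2)
    (x : Fin m₁ → ℝ) (y : Fin m₂ → ℝ) :
    Measurable (fun p : ℝ × (Fin m₁ → ℝ) => FF m₁ m₂ C s x y p.1 p.2) := by
  have ha : Measurable OUalpha := by unfold OUalpha; fun_prop
  have hs : Measurable OUsigma := by unfold OUsigma; fun_prop
  have hv : Measurable (fun p : ℝ × (Fin m₁ → ℝ) => OUalpha p.1 • x + OUsigma p.1 • p.2) := by
    fun_prop
  have hsv : Measurable (fun p : ℝ × (Fin m₁ → ℝ) =>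
      s (OUalpha p.1 • x + OUsigma p.1 • p.2) y p.1) :=
    hmeas.comp (hv.prodMk (measurable_const.prodMk measurable_fst))
  have hf : Measurable (fun p : ℝ × (Fin m₁ → ℝ) =>
      (norm2 (s (OUalpha p.1 • x + OUsigma p.1 • p.2) y p.1 + (OUsigma p.1)⁻¹ • p.2)) ^ 2) := by
    refine Measurable.pow_const (measurable_norm2.comp (hsv.add ?_)) 2
    fun_prop
  have hset : MeasurableSet {p : ℝ × (Fin m₁ → ℝ) | norm2 x ≤ C ∧
      norm2 (OUalpha p.1 • x + OUsigma p.1 • p.2) ≤ C} :=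
    (MeasurableSet.const _).inter (measurableSet_le (measurable_norm2.comp hv) measurable_const)
  exact hf.indicator hset

lemma FF_bound (m₁ m₂ : ℕ) (C B : ℝ)
    (s : (Fin m₁ → ℝ) → (Fin m₂ → ℝ) → ℝ → (Fin m₁ → ℝ))
    (x : Fin m₁ → ℝ) (y : Fin m₂ → ℝ) (t : ℝ) (ht : 0 < t)
    (hb : ∀ (v : Fin m₁ → ℝ), norm2 (s v y t) ≤ ((OUsigma t) ^ 2)⁻¹ * B) (z : Fin m₁ → ℝ) :
    ‖FF m₁ m₂ C s x y t z‖ ≤ (1 + t⁻¹) ^ 2 * (2 * B ^ 2 + 2 * norm2 z ^ 2) := by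
  unfold FF
  refine (norm_indicator_le_norm_self _ _).trans ?_
  rw [Real.norm_eq_abs, abs_of_nonneg (by positivity)]
  have h1 := norm2_add_le (s (OUalpha t • x + OUsigma t • z) y t) ((OUsigma t)⁻¹ • z)
  rw [norm2_smul] at h1
  have h2 := hb (OUalpha t • x + OUsigma t • z)
  have h3 := mul_le_mul_of_nonneg_right (OUsigma_inv_le ht) (norm2_nonneg z)
  have h4 := OUsigma_sq_inv_le ht
  have h0 : 0 ≤ ((OUsigma t) ^ 2)⁻¹ := by positivity
  set k := ((OUsigma t) ^ 2)⁻¹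
  have h5 : norm2 (s (OUalpha t • x + OUsigma t • z) y t + (OUsigma t)⁻¹ • z) ≤
      k * (B + norm2 z) := by linarith
  calc _ ≤ (k * (B + norm2 z)) ^ 2 := pow_le_pow_left₀ (norm2_nonneg _) h5 2
    _ = k ^ 2 * (B + norm2 z) ^ 2 := by ring
    _ ≤ (1 + t⁻¹) ^ 2 * (2 * B ^ 2 + 2 * norm2 z ^ 2) := by
      gcongr
      nlinarith [sq_nonneg (B - norm2 z)]

lemma FF_integrable (m₁ m₂ : ℕ) (C B : ℝ)
    (s : (Fin m₁ → ℝ) → (Fin m₂ → ℝ) → ℝ → (Fin m₁ → ℝ))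
    (hmeas : Measurable fun p : (Fin m₁ → ℝ) × (Fin m₂ → ℝ) × ℝ => s p.1 p.2.1 p.2.2)
    (x : Fin m₁ → ℝ) (y : Fin m₂ → ℝ) (t : ℝ) (ht : 0 < t)
    (hb : ∀ (v : Fin m₁ → ℝ), norm2 (s v y t) ≤ ((OUsigma t) ^ 2)⁻¹ * B) :
    Integrable (FF m₁ m₂ C s x y t)
      (gaussMeasure (0 : Fin m₁ → ℝ) (1 : Matrix (Fin m₁) (Fin m₁) ℝ)) := by
  refine Integrable.mono' (g := fun z => (1 + t⁻¹) ^ 2 * (2 * B ^ 2 + 2 * norm2 z ^ 2)) ?_ ?_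
    (ae_of_all _ (FF_bound m₁ m₂ C B s x y t ht hb))
  · exact ((integrable_const _).add ((integrable_norm2_sq m₁).const_mul 2)).const_mul _
  · exact ((FF_meas m₁ m₂ C s hmeas x y).comp measurable_prodMk_left).aestronglyMeasurable

lemma FF_int_integrable (m₁ m₂ : ℕ) (t₀ T C B : ℝ) (ht₀ : 0 < t₀) (hT : t₀ ≤ T)
    (s : (Fin m₁ → ℝ) → (Fin m₂ → ℝ) → ℝ → (Fin m₁ → ℝ))
    (hmeas : Measurable fun p : (Fin m₁ → ℝ) × (Fin m₂ → ℝ) × ℝ => s p.1 p.2.1 p.2.2)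
    (x : Fin m₁ → ℝ) (y : Fin m₂ → ℝ)
    (hb : ∀ (v : Fin m₁ → ℝ) (y : Fin m₂ → ℝ) (t : ℝ), t ∈ Set.Icc t₀ T →
      norm2 (s v y t) ≤ ((OUsigma t) ^ 2)⁻¹ * B) :
    IntervalIntegrable (fun t => ∫ z, FF m₁ m₂ C s x y t z
      ∂(gaussMeasure (0 : Fin m₁ → ℝ) (1 : Matrix (Fin m₁) (Fin m₁) ℝ))) volume t₀ T := by
  rw [intervalIntegrable_iff_integrableOn_Icc_of_le hT]
  have hm := (FF_meas m₁ m₂ C s hmeas x y).stronglyMeasurable.integral_prod_right'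
    (ν := gaussMeasure (0 : Fin m₁ → ℝ) (1 : Matrix (Fin m₁) (Fin m₁) ℝ))
  refine Measure.integrableOn_of_bounded (M := (1 + t₀⁻¹) ^ 2 * (2 * B ^ 2 + 2 * m₁)) (by simp)
    hm.aestronglyMeasurable ?_
  rw [ae_restrict_iff' measurableSet_Icc]
  refine ae_of_all _ fun t ht => ?_
  have ht0 : 0 < t := ht₀.trans_le ht.1
  have hi : Integrable (fun z : Fin m₁ → ℝ => (1 + t⁻¹) ^ 2 * (2 * B ^ 2 + 2 * norm2 z ^ 2))
      (gaussMeasure (0 : Fin m₁ → ℝ) (1 : Matrix (Fin m₁) (Fin m₁) ℝ)) :=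
    ((integrable_const _).add ((integrable_norm2_sq m₁).const_mul 2)).const_mul _
  refine (norm_integral_le_of_norm_le hi
    (ae_of_all _ (FF_bound m₁ m₂ C B s x y t ht0 fun v => hb v y t ht))).trans ?_
  rw [integral_const_mul, integral_add (integrable_const _) ((integrable_norm2_sq m₁).const_mul 2),
    integral_const_mul 2 (fun z : Fin m₁ → ℝ => norm2 z ^ 2), integral_norm2_sq]
  simp only [integral_const, probReal_univ, one_smul]
  have := inv_anti₀ ht₀ ht.1
  gcongr

lemma FF_diff (m₁ m₂ : ℕ) (hm₁ : 1 ≤ m₁) (C B δ : ℝ) (hδ : 0 < δ) (hB : 0 < B)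
    (s₁ s₂ : (Fin m₁ → ℝ) → (Fin m₂ → ℝ) → ℝ → (Fin m₁ → ℝ))
    (x : Fin m₁ → ℝ) (y : Fin m₂ → ℝ) (t : ℝ) (ht : 0 < t)
    (hb₁ : ∀ (v : Fin m₁ → ℝ), norm2 (s₁ v y t) ≤ ((OUsigma t) ^ 2)⁻¹ * B)
    (hb₂ : ∀ (v : Fin m₁ → ℝ), norm2 (s₂ v y t) ≤ ((OUsigma t) ^ 2)⁻¹ * B)
    (hclose : ∀ (v : Fin m₁ → ℝ), norm2 v ≤ C → norm2 (s₁ v y t - s₂ v y t) ≤ δ)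
    (z : Fin m₁ → ℝ) :
    ‖FF m₁ m₂ C s₁ x y t z - FF m₁ m₂ C s₂ x y t z‖ ≤
      (2 * δ * (1 + t⁻¹)) * (B + (Real.sqrt m₁ / 2 + (2 * Real.sqrt m₁)⁻¹ * norm2 z ^ 2)) := by
  have hm : 0 < Real.sqrt m₁ := Real.sqrt_pos.2 (by exact_mod_cast hm₁)
  have hz : norm2 z ≤ Real.sqrt m₁ / 2 + (2 * Real.sqrt m₁)⁻¹ * norm2 z ^ 2 := by
    have : Real.sqrt m₁ / 2 + (2 * Real.sqrt m₁)⁻¹ * norm2 z ^ 2 - norm2 z =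
      (2 * Real.sqrt m₁)⁻¹ * (norm2 z - Real.sqrt m₁) ^ 2 := by field_simp; ring
    have h2 : 0 ≤ (2 * Real.sqrt m₁)⁻¹ * (norm2 z - Real.sqrt m₁) ^ 2 := by positivity
    linarith
  have ht' : 0 < t⁻¹ := by positivity
  unfold FF
  by_cases h : z ∈ {z' : Fin m₁ → ℝ | norm2 x ≤ C ∧ norm2 (OUalpha t • x + OUsigma t • z') ≤ C}
  · rw [Set.indicator_of_mem h, Set.indicator_of_mem h, Real.norm_eq_abs]
    have hc := hclose _ h.2
    have h1 := norm2_add_le (s₁ (OUalpha t • x + OUsigma t • z) y t) ((OUsigma t)⁻¹ • z)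
    have h1' := norm2_add_le (s₂ (OUalpha t • x + OUsigma t • z) y t) ((OUsigma t)⁻¹ • z)
    rw [norm2_smul] at h1 h1'
    have h2 := hb₁ (OUalpha t • x + OUsigma t • z)
    have h2' := hb₂ (OUalpha t • x + OUsigma t • z)
    have h3 := mul_le_mul_of_nonneg_right (OUsigma_inv_le ht) (norm2_nonneg z)
    have h4 := OUsigma_sq_inv_le ht
    have h6 := abs_norm2_sub_le
      (s₁ (OUalpha t • x + OUsigma t • z) y t + (OUsigma t)⁻¹ • z)
      (s₂ (OUalpha t • x + OUsigma t • z) y t + (OUsigma t)⁻¹ • z)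
    rw [add_sub_add_right_eq_sub] at h6
    have hn1 := norm2_nonneg (s₁ (OUalpha t • x + OUsigma t • z) y t + (OUsigma t)⁻¹ • z)
    have hn2 := norm2_nonneg (s₂ (OUalpha t • x + OUsigma t • z) y t + (OUsigma t)⁻¹ • z)
    have hk := mul_le_mul_of_nonneg_right h4 (by linarith [norm2_nonneg z] : 0 ≤ B + norm2 z)
    generalize norm2 (s₁ (OUalpha t • x + OUsigma t • z) y t + (OUsigma t)⁻¹ • z) = a at *
    generalize norm2 (s₂ (OUalpha t • x + OUsigma t • z) y t + (OUsigma t)⁻¹ • z) = b at *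
    have hab : a + b ≤ 2 * ((1 + t⁻¹) * (B + norm2 z)) := by linarith
    calc |a ^ 2 - b ^ 2| = |a - b| * (a + b) := by
          rw [sq_sub_sq, abs_mul, abs_of_nonneg (by linarith : 0 ≤ a + b), mul_comm]
      _ ≤ δ * (2 * ((1 + t⁻¹) * (B + norm2 z))) :=
          mul_le_mul (h6.trans hc) hab (by linarith) hδ.le
      _ = (2 * δ * (1 + t⁻¹)) * (B + norm2 z) := by ring
      _ ≤ _ := by gcongr
  · rw [Set.indicator_of_notMem h, Set.indicator_of_notMem h, sub_zero, norm_zero]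
    positivity

/-- if two score networks are uniformly bounded by `σ_t⁻²B` and differ by
at most `δ` on the truncated region, then their truncated score-matching losses differ by
at most `4δ(T + log(1/t₀))(B + √m₁)`. -/
theorem truncated_loss_difference_bound
    (m₁ m₂ : ℕ) (hm₁ : 1 ≤ m₁) (hm₂ : 1 ≤ m₂)
    (t₀ T C B δ : ℝ) (ht₀ : 0 < t₀) (ht₀le : t₀ ≤ 1) (hT : 1 ≤ T)
    (hC : 0 < C) (hB : 0 < B) (hδ : 0 < δ)
    (s₁ s₂ : (Fin m₁ → ℝ) → (Fin m₂ → ℝ) → ℝ → (Fin m₁ → ℝ))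
    (hmeas₁ : Measurable fun p : (Fin m₁ → ℝ) × (Fin m₂ → ℝ) × ℝ => s₁ p.1 p.2.1 p.2.2)
    (hmeas₂ : Measurable fun p : (Fin m₁ → ℝ) × (Fin m₂ → ℝ) × ℝ => s₂ p.1 p.2.1 p.2.2)
    (hb₁ : ∀ (v : Fin m₁ → ℝ) (y : Fin m₂ → ℝ) (t : ℝ), t ∈ Set.Icc t₀ T →
      norm2 (s₁ v y t) ≤ ((OUsigma t) ^ 2)⁻¹ * B)
    (hb₂ : ∀ (v : Fin m₁ → ℝ) (y : Fin m₂ → ℝ) (t : ℝ), t ∈ Set.Icc t₀ T →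
      norm2 (s₂ v y t) ≤ ((OUsigma t) ^ 2)⁻¹ * B)
    (hclose : ∀ (t : ℝ), t ∈ Set.Icc t₀ T → ∀ (v : Fin m₁ → ℝ) (y : Fin m₂ → ℝ),
      norm2 v ≤ C → norm2 y ≤ C → norm2 (s₁ v y t - s₂ v y t) ≤ δ) :
    ∀ (x : Fin m₁ → ℝ) (y : Fin m₂ → ℝ), norm2 x ≤ C → norm2 y ≤ C →
      |ltrunc m₁ m₂ t₀ T C s₁ x y - ltrunc m₁ m₂ t₀ T C s₂ x y| ≤
        4 * δ * (T + Real.log (1 / t₀)) * (B + Real.sqrt m₁) := by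
  intro x y hx hy
  have hTt : t₀ ≤ T := ht₀le.trans hT
  have hm : 0 < Real.sqrt m₁ := Real.sqrt_pos.2 (by exact_mod_cast hm₁)
  have e : ∀ s, ltrunc m₁ m₂ t₀ T C s x y = ∫ t in t₀..T, ∫ z, FF m₁ m₂ C s x y t z
      ∂(gaussMeasure (0 : Fin m₁ → ℝ) (1 : Matrix (Fin m₁) (Fin m₁) ℝ)) := fun s => rfl
  rw [e, e, ← intervalIntegral.integral_sub
    (FF_int_integrable m₁ m₂ t₀ T C B ht₀ hTt s₁ hmeas₁ x y hb₁)
    (FF_int_integrable m₁ m₂ t₀ T C B ht₀ hTt s₂ hmeas₂ x y hb₂), ← Real.norm_eq_abs]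
  have hinv : IntervalIntegrable (fun t : ℝ => t⁻¹) volume t₀ T := by
    apply intervalIntegral.intervalIntegrable_inv
    · intro t ht
      rw [Set.uIcc_of_le hTt] at ht
      exact (ht₀.trans_le ht.1).ne'
    · exact continuousOn_id
  have hg : IntervalIntegrable (fun t : ℝ => 2 * δ * (B + Real.sqrt m₁) * (1 + t⁻¹))
      volume t₀ T := (intervalIntegrable_const.add hinv).const_mul _
  refine (intervalIntegral.norm_integral_le_of_norm_le hTt (ae_of_all _ fun t ht => ?_) hg).trans ?_
  · have ht0 : 0 < t := ht₀.trans ht.1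
    have htI : t ∈ Set.Icc t₀ T := ⟨ht.1.le, ht.2⟩
    rw [← integral_sub
      (FF_integrable m₁ m₂ C B s₁ hmeas₁ x y t ht0 fun v => hb₁ v y t htI)
      (FF_integrable m₁ m₂ C B s₂ hmeas₂ x y t ht0 fun v => hb₂ v y t htI)]
    have hi0 := (integrable_norm2_sq m₁).const_mul (2 * Real.sqrt m₁)⁻¹
    have hi1 := (integrable_const (μ := gaussMeasure (0 : Fin m₁ → ℝ)
      (1 : Matrix (Fin m₁) (Fin m₁) ℝ)) (Real.sqrt m₁ / 2)).add hi0
    have hi2 := (integrable_const (μ := gaussMeasure (0 : Fin m₁ → ℝ)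
      (1 : Matrix (Fin m₁) (Fin m₁) ℝ)) B).add hi1
    refine (norm_integral_le_of_norm_le (hi2.const_mul (2 * δ * (1 + t⁻¹)))
      (ae_of_all _ (FF_diff m₁ m₂ hm₁ C B δ hδ hB s₁ s₂ x y t ht0 (fun v => hb₁ v y t htI)
        (fun v => hb₂ v y t htI) fun v hv => hclose t htI v y hv hy))).trans (le_of_eq ?_)
    rw [integral_const_mul, integral_add' (integrable_const _) hi1,
      integral_add' (integrable_const _) hi0, integral_const_mul, integral_norm2_sq]
    simp only [integral_const, probReal_univ, one_smul]
    have hsq : (m₁ : ℝ) = Real.sqrt m₁ * Real.sqrt m₁ := (Real.mul_self_sqrt (by positivity)).symm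
    have : (2 * Real.sqrt m₁)⁻¹ * (m₁ : ℝ) = Real.sqrt m₁ / 2 := by
      nth_rewrite 2 [hsq]
      field_simp
    rw [this]
    ring
  · rw [intervalIntegral.integral_const_mul, intervalIntegral.integral_add
      intervalIntegrable_const hinv, integral_inv_of_pos ht₀ (by linarith),
      intervalIntegral.integral_const, Real.log_div (by linarith) ht₀.ne', one_div, Real.log_inv]
    have h1 : Real.log T ≤ T - 1 := Real.log_le_sub_one_of_pos (by linarith)
    have h2 : Real.log t₀ ≤ 0 := Real.log_nonpos ht₀.le ht₀le
    have h3 : (T - t₀) • (1 : ℝ) + (Real.log T - Real.log t₀) ≤ 2 * (T + -Real.log t₀) := by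
      rw [smul_eq_mul]; linarith
    calc _ ≤ 2 * δ * (B + Real.sqrt m₁) * (2 * (T + -Real.log t₀)) := by gcongr
      _ = _ := by ring

end
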